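/- The generalized Khinchin constants K_N = Π_{k=N}^∞ ((k+1)²/(k(k+2)))^{ln k/(ln(N+1) − ln N)} satisfy lim_{N→∞} K_N/N = e; equivalently, lim_{N→∞} (ln K_N − ln N) = 1. -/

import Mathlib

open Filter

/-- The generalized Khinchin constant
`K_N = ∏_{k=N}^∞ ((k+1)² / (k(k+2))) ^ (log k / (log (N+1) - log N))`
(the product is reindexed by `k = j + N`, `j : ℕ`). -/
noncomputable def khinchinConst (N : ℕ) : ℝ :=
  ∏' j : ℕ,
    ((((j : ℝ) + N + 1) ^ 2 / (((j : ℝ) + N) * ((j : ℝ) + N + 2))) ^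
      (Real.log ((j : ℝ) + N) / (Real.log (N + 1) - Real.log N)))

/-- `∑_{j ≥ 0} 1 / ((x + j) (x + j + 1)) = 1 / x`. -/
lemma hasSum_telescoping_inv {x : ℝ} (hx : 0 < x) :
    HasSum (fun j : ℕ => 1 / (((j : ℝ) + x) * ((j : ℝ) + x + 1))) (1 / x) := by
  rw [hasSum_iff_tendsto_nat_of_nonneg (fun j => by positivity)]
  have hsum : ∀ n : ℕ, ∑ j ∈ Finset.range n, 1 / (((j : ℝ) + x) * ((j : ℝ) + x + 1))
      = 1 / x - 1 / ((n : ℝ) + x) := by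
    intro n
    induction n with
    | zero => simp
    | succ n ih =>
      rw [Finset.sum_range_succ, ih]
      have h : 0 < (n : ℝ) + x := by positivity
      push_cast
      field_simp
      ring
  simp only [hsum]
  have hinv : Tendsto (fun n : ℕ => 1 / ((n : ℝ) + x)) atTop (nhds 0) := by
    simp only [one_div]
    exact (tendsto_atTop_add_const_right _ _ tendsto_natCast_atTop_atTop).inv_tendsto_atTop
  simpa using hinv.const_sub (1 / x)

/-- The increment `log (x + 1) - log x`. -/
noncomputable def logStep (x : ℝ) : ℝ := Real.log (x + 1) - Real.log x

lemma logStep_le {x : ℝ} (hx : 0 < x) : logStep x ≤ 1 / x := by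
  rw [logStep, ← Real.log_div (by positivity) hx.ne']
  refine (Real.log_le_sub_one_of_pos (by positivity)).trans_eq ?_
  field_simp
  ring

lemma le_logStep {x : ℝ} (hx : 0 < x) : 1 / (x + 1) ≤ logStep x := by
  rw [logStep, ← Real.log_div (by positivity) hx.ne']
  refine le_trans (le_of_eq ?_) (Real.one_sub_inv_le_log_of_pos (by positivity))
  field_simp
  ring

lemma logStep_pos {x : ℝ} (hx : 0 < x) : 0 < logStep x :=
  lt_of_lt_of_le (by positivity) (le_logStep hx)

lemma logStep_mul_le {x : ℝ} (hx : 0 < x) :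
    logStep x * logStep (x + 1) ≤ 1 / (x * (x + 1)) := by
  have h : 0 < x + 1 := by positivity
  calc logStep x * logStep (x + 1) ≤ 1 / x * (1 / (x + 1)) :=
        mul_le_mul (logStep_le hx) (logStep_le h) (logStep_pos h).le (by positivity)
    _ = 1 / (x * (x + 1)) := by field_simp

lemma le_logStep_mul {x : ℝ} (hx : 0 < x) :
    1 / ((x + 1) * (x + 1 + 1)) ≤ logStep x * logStep (x + 1) := by
  have h : 0 < x + 1 := by positivity
  calc 1 / ((x + 1) * (x + 1 + 1)) = 1 / (x + 1) * (1 / (x + 1 + 1)) := by field_simp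
    _ ≤ logStep x * logStep (x + 1) :=
        mul_le_mul (le_logStep hx) (le_logStep h) (by positivity) (logStep_pos hx).le

lemma logStep_sub_nonneg {x : ℝ} (hx : 0 < x) : 0 ≤ logStep x - logStep (x + 1) :=
  sub_nonneg.2 ((logStep_le (by positivity)).trans (le_logStep hx))

lemma summable_logStep_mul {x : ℝ} (hx : 0 < x) :
    Summable (fun j : ℕ => logStep ((j : ℝ) + x) * logStep ((j : ℝ) + x + 1)) :=
  (hasSum_telescoping_inv hx).summable.of_nonneg_of_le
    (fun _ => mul_nonneg (logStep_pos (by positivity)).le (logStep_pos (by positivity)).le)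
    (fun _ => logStep_mul_le (by positivity))

lemma tsum_logStep_mul_le {x : ℝ} (hx : 0 < x) :
    ∑' j : ℕ, logStep ((j : ℝ) + x) * logStep ((j : ℝ) + x + 1) ≤ 1 / x :=
  hasSum_le (fun _ => logStep_mul_le (by positivity)) (summable_logStep_mul hx).hasSum
    (hasSum_telescoping_inv hx)

lemma le_tsum_logStep_mul {x : ℝ} (hx : 0 < x) :
    1 / (x + 1) ≤ ∑' j : ℕ, logStep ((j : ℝ) + x) * logStep ((j : ℝ) + x + 1) := by
  refine hasSum_le (fun j => ?_) (hasSum_telescoping_inv (by positivity : 0 < x + 1))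
    (summable_logStep_mul hx).hasSum
  simpa only [add_assoc] using le_logStep_mul (by positivity : 0 < (j : ℝ) + x)

lemma tendsto_log_mul_logStep :
    Tendsto (fun x : ℝ => Real.log x * logStep x) atTop (nhds 0) := by
  have hlim : Tendsto (fun x : ℝ => Real.log x * (1 / x)) atTop (nhds 0) := by
    simpa [div_eq_mul_inv] using Real.isLittleO_log_id_atTop.tendsto_div_nhds_zero
  refine squeeze_zero' ?_ ?_ hlim
  all_goals
    filter_upwards [eventually_ge_atTop 1] with x hx
    have h := Real.log_nonneg hx
  · exact mul_nonneg h (logStep_pos (by linarith)).le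
  · exact mul_le_mul_of_nonneg_left (logStep_le (by linarith)) h

/-- Summation by parts for `∑ log k (log (1 + 1 / k) - log (1 + 1 / (k + 1)))`. -/
lemma sum_log_mul_logStep_sub (x : ℝ) (n : ℕ) :
    ∑ j ∈ Finset.range n,
        Real.log ((j : ℝ) + x) * (logStep ((j : ℝ) + x) - logStep ((j : ℝ) + x + 1))
      = Real.log x * logStep x - Real.log ((n : ℝ) + x) * logStep ((n : ℝ) + x)
        + ∑ j ∈ Finset.range n, logStep ((j : ℝ) + x) * logStep ((j : ℝ) + x + 1) := by
  induction n with
  | zero => simp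
  | succ n ih =>
    have hlog : Real.log ((n : ℝ) + x + 1) = Real.log ((n : ℝ) + x) + logStep ((n : ℝ) + x) := by
      simp [logStep]
    rw [Finset.sum_range_succ, Finset.sum_range_succ, ih]
    push_cast
    rw [add_right_comm (n : ℝ) 1 x, hlog]
    ring

lemma hasSum_log_mul_logStep_sub {x : ℝ} (hx : 1 ≤ x) :
    HasSum (fun j : ℕ =>
        Real.log ((j : ℝ) + x) * (logStep ((j : ℝ) + x) - logStep ((j : ℝ) + x + 1)))
      (Real.log x * logStep x
        + ∑' j : ℕ, logStep ((j : ℝ) + x) * logStep ((j : ℝ) + x + 1)) := by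
  have hx0 : 0 < x := by linarith
  rw [hasSum_iff_tendsto_nat_of_nonneg]
  · simp only [sum_log_mul_logStep_sub]
    refine Tendsto.add ?_ (summable_logStep_mul hx0).hasSum.tendsto_sum_nat
    have h := tendsto_log_mul_logStep.comp
      (tendsto_atTop_add_const_right _ x (tendsto_natCast_atTop_atTop (R := ℝ)))
    simpa using h.const_sub (Real.log x * logStep x)
  · intro j
    have hj : (0 : ℝ) ≤ j := j.cast_nonneg
    exact mul_nonneg (Real.log_nonneg (by linarith)) (logStep_sub_nonneg (by positivity))

lemma khinchinConst_eq_exp {N : ℕ} (hN : 1 ≤ N) :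
    khinchinConst N = Real.exp (Real.log N
      + (∑' j : ℕ, logStep ((j : ℝ) + N) * logStep ((j : ℝ) + N + 1)) / logStep N) := by
  have hx : (1 : ℝ) ≤ N := by exact_mod_cast hN
  have hL : 0 < logStep N := logStep_pos (by linarith)
  have h := ((hasSum_log_mul_logStep_sub hx).div_const (logStep N)).rexp.tprod_eq
  rw [add_div, mul_div_cancel_right₀ _ hL.ne'] at h
  rw [← h, khinchinConst]
  refine tprod_congr fun j => ?_
  have hj : 0 < (j : ℝ) + N := by positivity
  rw [Real.rpow_def_of_pos (by positivity), Real.log_div (by positivity) (by positivity),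
    Real.log_pow, Real.log_mul (by positivity) (by positivity)]
  simp only [Function.comp_apply, logStep]
  rw [show (j : ℝ) + N + 1 + 1 = (j : ℝ) + N + 2 by ring]
  congr 1
  push_cast
  ring

lemma tendsto_tsum_logStep_mul_div :
    Tendsto (fun x : ℝ =>
        (∑' j : ℕ, logStep ((j : ℝ) + x) * logStep ((j : ℝ) + x + 1)) / logStep x)
      atTop (nhds 1) := by
  have hinv : Tendsto (fun x : ℝ => 1 + x⁻¹) atTop (nhds 1) := by
    simpa using tendsto_inv_atTop_zero.const_add (1 : ℝ)
  refine tendsto_of_tendsto_of_tendsto_of_le_of_le' (by simpa using hinv.inv₀ one_ne_zero)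
    hinv ?_ ?_
  all_goals
    filter_upwards [eventually_gt_atTop 0] with x hx
    have hL := logStep_pos hx
  · rw [le_div_iff₀ hL]
    calc (1 + x⁻¹)⁻¹ * logStep x ≤ (1 + x⁻¹)⁻¹ * (1 / x) := by
          gcongr
          exact logStep_le hx
      _ = 1 / (x + 1) := by field_simp
      _ ≤ _ := le_tsum_logStep_mul hx
  · rw [div_le_iff₀ hL]
    calc _ ≤ 1 / x := tsum_logStep_mul_le hx
      _ = (1 + x⁻¹) * (1 / (x + 1)) := by field_simp
      _ ≤ (1 + x⁻¹) * logStep x := by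
          gcongr
          exact le_logStep hx

/-- `lim_{N→∞} K_N / N = e`; equivalently, `lim_{N→∞} (log K_N - log N) = 1`. -/
theorem khinchinConst_limit :
    Tendsto (fun N : ℕ => khinchinConst N / N) atTop (nhds (Real.exp 1)) ∧
    Tendsto (fun N : ℕ => Real.log (khinchinConst N) - Real.log N) atTop (nhds 1) := by
  have h := tendsto_tsum_logStep_mul_div.comp (tendsto_natCast_atTop_atTop (R := ℝ))
  constructor
  · refine ((Real.continuous_exp.tendsto 1).comp h).congr' ?_
    filter_upwards [eventually_ge_atTop 1] with N hN
    have hN0 : (0 : ℝ) < N := by exact_mod_cast hN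
    rw [khinchinConst_eq_exp hN, Real.exp_add, Real.exp_log hN0, mul_div_cancel_left₀ _ hN0.ne']
    rfl
  · refine h.congr' ?_
    filter_upwards [eventually_ge_atTop 1] with N hN
    rw [khinchinConst_eq_exp hN, Real.log_exp, add_sub_cancel_left]
    rfl
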